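/- arXiv:2509.01266 — 2 statements merged into one kernel-verified Lean document; each statement's English description precedes it below -/
import Mathlib

section
/- Let d ≥ 1 and λ > 3d/2. Let F be a distribution on 𝕋^d × 𝕋^d and M ≥ 0 such that |⟨F, h ⊗ h̃⟩| ≤ M ‖h‖_{H^{-λ-2}(𝕋^d)} ‖h̃‖_{H^{-λ-2}(𝕋^d)} for all smooth functions h, h̃ on 𝕋^d, where h ⊗ h̃ denotes the product distribution (h ⊗ h̃)(x,y) = h(x)h̃(y). Then for every λ̃ ∈ (3d/2, λ) one has F ∈ H^{λ̃+2−d/2}(𝕋^d × 𝕋^d) with ‖F‖_{H^{λ̃+2−d/2}(𝕋^d × 𝕋^d)} ≤ C M for a constant C depending only on d, λ and λ̃. -/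
open MeasureTheory Complex Filter
open scoped BigOperators

noncomputable section
namespace PaperTorus

/-- The lattice `ℤ^d` of Fourier modes of the torus `𝕋^d = (ℝ/ℤ)^d`. -/
abbrev Lat (d : ℕ) := Fin d → ℤ

/-- A distribution `f` on the torus `𝕋^d`, encoded by the family of its pairings
`⟨f, e_k⟩ = f(e_k)` with the characters `e_k(x) = exp(2πi k·x)`, `k ∈ ℤ^d`. -/
abbrev Coef (d : ℕ) := Lat d → ℂ

/-- The Japanese bracket `⟨k⟩ = (1 + |k|²)^(1/2)`. -/
def jap {d : ℕ} (k : Lat d) : ℝ := Real.sqrt (1 + ∑ i, ((k i : ℝ)) ^ 2)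

/-- Membership `f ∈ Hˢ(𝕋^d)`: the series `Σ_k ⟨k⟩^(2s) |⟨f,e_k⟩|²` converges. -/
def MemSob {d : ℕ} (s : ℝ) (f : Coef d) : Prop :=
  Summable fun k : Lat d => jap k ^ (2 * s) * ‖f k‖ ^ 2

/-- The Sobolev norm `‖f‖_{Hˢ(𝕋^d)} = (Σ_k ⟨k⟩^(2s) |⟨f,e_k⟩|²)^(1/2)`. -/
def sobNorm {d : ℕ} (s : ℝ) (f : Coef d) : ℝ :=
  Real.sqrt (∑' k : Lat d, jap k ^ (2 * s) * ‖f k‖ ^ 2)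

/-- The inner product `⟨f,g⟩_{Hˢ(𝕋^d)} = Σ_k ⟨k⟩^(2s) ⟨f,e_k⟩ conj(⟨g,e_k⟩)`. -/
def sobInner {d : ℕ} (s : ℝ) (f g : Coef d) : ℂ :=
  ∑' k : Lat d, ((jap k ^ (2 * s) : ℝ) : ℂ) * f k * (starRingEnd ℂ) (g k)

/-- A distribution on `𝕋^d × 𝕋^d`, encoded by its pairings with the characters
`e_{(k₁,k₂)}(x,y) = e_{k₁}(x) e_{k₂}(y)`. -/
abbrev Coef2 (d : ℕ) := (Lat d × Lat d) → ℂ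

/-- The Japanese bracket on `ℤ^d × ℤ^d`. -/
def jap2 {d : ℕ} (k : Lat d × Lat d) : ℝ :=
  Real.sqrt (1 + ∑ i, ((k.1 i : ℝ)) ^ 2 + ∑ i, ((k.2 i : ℝ)) ^ 2)

/-- Membership `F ∈ Hˢ(𝕋^d × 𝕋^d)`. -/
def MemSob2 {d : ℕ} (s : ℝ) (F : Coef2 d) : Prop :=
  Summable fun k : Lat d × Lat d => jap2 k ^ (2 * s) * ‖F k‖ ^ 2

/-- The Sobolev norm `‖F‖_{Hˢ(𝕋^d × 𝕋^d)}`. -/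
def sobNorm2 {d : ℕ} (s : ℝ) (F : Coef2 d) : ℝ :=
  Real.sqrt (∑' k : Lat d × Lat d, jap2 k ^ (2 * s) * ‖F k‖ ^ 2)

/-- Smoothness of a function on the torus, characterized by the rapid decay of its
Fourier pairings. -/
def RapidDecay {d : ℕ} (h : Coef d) : Prop :=
  ∀ M : ℝ, ∃ C : ℝ, ∀ k : Lat d, ‖h k‖ ≤ C * jap k ^ (-M)

/-- A real distribution: `conj ⟨h, e_k⟩ = ⟨h, e_{-k}⟩`. -/
def IsRealDist {d : ℕ} (h : Coef d) : Prop :=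
  ∀ k : Lat d, (starRingEnd ℂ) (h k) = h (-k)

/-- The pairing `⟨F, h ⊗ h̃⟩` of a distribution `F` on `𝕋^d × 𝕋^d` with the product
`(h ⊗ h̃)(x,y) = h(x)h̃(y)` of two smooth functions: since `∫ e_m e_k = δ_{m,-k}`,
`⟨F, h ⊗ h̃⟩ = Σ_{(k₁,k₂)} ⟨h, e_{-k₁}⟩ ⟨h̃, e_{-k₂}⟩ F(k₁,k₂)`. -/
def pairTensor {d : ℕ} (F : Coef2 d) (h h' : Coef d) : ℂ :=
  ∑' k : Lat d × Lat d, h (-k.1) * h' (-k.2) * F k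

lemma one_le_jap {d : ℕ} (k : Lat d) : 1 ≤ jap k := by
  unfold jap
  rw [Real.one_le_sqrt]
  have : 0 ≤ ∑ i, ((k i : ℝ)) ^ 2 := Finset.sum_nonneg fun i _ => sq_nonneg _
  linarith

lemma jap_pos {d : ℕ} (k : Lat d) : 0 < jap k := lt_of_lt_of_le one_pos (one_le_jap k)

lemma jap_neg {d : ℕ} (k : Lat d) : jap (-k) = jap k := by
  simp [jap]

lemma jap2_pos {d : ℕ} (k : Lat d × Lat d) : 0 < jap2 k := by
  unfold jap2
  apply Real.sqrt_pos.mpr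
  have h1 : 0 ≤ ∑ i, ((k.1 i : ℝ)) ^ 2 := Finset.sum_nonneg fun i _ => sq_nonneg _
  have h2 : 0 ≤ ∑ i, ((k.2 i : ℝ)) ^ 2 := Finset.sum_nonneg fun i _ => sq_nonneg _
  linarith

lemma jap2_le {d : ℕ} (k : Lat d × Lat d) : jap2 k ≤ jap k.1 * jap k.2 := by
  unfold jap2 jap
  have h1 : 0 ≤ ∑ i, ((k.1 i : ℝ)) ^ 2 := Finset.sum_nonneg fun i _ => sq_nonneg _
  have h2 : 0 ≤ ∑ i, ((k.2 i : ℝ)) ^ 2 := Finset.sum_nonneg fun i _ => sq_nonneg _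
  rw [← Real.sqrt_mul (by linarith)]
  apply Real.sqrt_le_sqrt
  nlinarith [mul_nonneg h1 h2]

lemma summable_jap {d : ℕ} (r : ℝ) (hr : r < -(d : ℝ)) :
    Summable fun k : Lat d => jap k ^ r := by
  set L := Submodule.span ℤ (Set.range (Pi.basisFun ℝ (Fin d))) with hL
  have hrank : Module.finrank ℤ L = d := by
    rw [ZLattice.rank ℝ L]; simp
  have hS := ZLattice.summable_norm_rpow L r (by rw [hrank]; exact hr)
  have hmem : ∀ k : Lat d, (fun i => (k i : ℝ)) ∈ L := by
    intro k
    rw [hL, Module.Basis.mem_span_iff_repr_mem]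
    intro i
    exact ⟨k i, by simp⟩
  let φ : Lat d → L := fun k => ⟨fun i => (k i : ℝ), hmem k⟩
  have hφ : Function.Injective φ := by
    intro a b hab
    have := congrArg Subtype.val hab
    funext i
    have := congrFun this i
    simpa [φ] using this
  have hS2 := hS.comp_injective hφ
  refine Summable.of_norm_bounded_eventually hS2 ?_
  refine (Set.finite_singleton (0 : Lat d)).subset ?_
  intro k hk
  by_contra hk0
  apply hk
  have hk0' : k ≠ 0 := hk0
  have hpos : 0 < ‖φ k‖ := by
    rw [norm_pos_iff]
    intro h
    apply hk0'
    apply hφ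
    rw [h]
    ext i
    simp [φ]
  have hle : ‖φ k‖ ≤ jap k := by
    change ‖(fun i => (k i : ℝ))‖ ≤ jap k
    rw [pi_norm_le_iff_of_nonneg (jap_pos k).le]
    intro i
    rw [Real.norm_eq_abs]
    apply Real.le_sqrt_of_sq_le
    rw [sq_abs]
    have := Finset.single_le_sum (f := fun i => ((k i : ℝ)) ^ 2)
      (fun i _ => sq_nonneg _) (Finset.mem_univ i)
    linarith
  change ‖jap k ^ r‖ ≤ ‖φ k‖ ^ r
  rw [Real.norm_of_nonneg (Real.rpow_nonneg (jap_pos k).le _)]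
  apply Real.rpow_le_rpow_of_nonpos hpos hle
  have : (0 : ℝ) ≤ d := Nat.cast_nonneg d
  linarith

/-- real test function `z e + conj z e`, supported on `±k`. -/
def tst {d : ℕ} (k : Lat d) (z : ℂ) : Coef d := fun m =>
  z * (if m = k then 1 else 0) + (starRingEnd ℂ) z * (if m = -k then 1 else 0)

lemma tst_real {d : ℕ} (k : Lat d) (z : ℂ) : IsRealDist (tst k z) := by
  intro m
  have e1 : (-m = k) ↔ (m = -k) := neg_eq_iff_eq_neg
  simp only [tst, map_add, map_mul, Complex.conj_conj, neg_inj, e1, apply_ite (starRingEnd ℂ),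
    map_one, map_zero]
  ring

lemma tst_zero {d : ℕ} (k : Lat d) (z : ℂ) (m : Lat d) (hm : m ∉ ({k, -k} : Finset (Lat d))) :
    tst k z m = 0 := by
  simp only [Finset.mem_insert, Finset.mem_singleton, not_or] at hm
  simp [tst, hm.1, hm.2]

lemma tst_norm {d : ℕ} (k : Lat d) (z : ℂ) (hz : ‖z‖ = 1) (m : Lat d) : ‖tst k z m‖ ≤ 2 := by
  unfold tst
  refine (norm_add_le _ _).trans ?_
  rw [norm_mul, norm_mul, RCLike.norm_conj, hz]
  have h1 : ‖(if m = k then (1 : ℂ) else 0)‖ ≤ 1 := by split_ifs <;> simp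
  have h2 : ‖(if m = -k then (1 : ℂ) else 0)‖ ≤ 1 := by split_ifs <;> simp
  linarith

lemma tst_rapid {d : ℕ} (k : Lat d) (z : ℂ) (hz : ‖z‖ = 1) : RapidDecay (tst k z) := by
  intro M
  refine ⟨2 * jap k ^ M, fun m => ?_⟩
  by_cases hm : m ∈ ({k, -k} : Finset (Lat d))
  · have : jap m = jap k := by
      simp only [Finset.mem_insert, Finset.mem_singleton] at hm
      rcases hm with h | h <;> simp [h, jap_neg]
    rw [this, mul_assoc, ← Real.rpow_add (jap_pos k)]
    simpa using tst_norm k z hz m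
  · rw [tst_zero k z m hm, norm_zero]
    have := Real.rpow_nonneg (jap_pos k).le M
    have := Real.rpow_nonneg (jap_pos m).le (-M)
    positivity

lemma tst_sob {d : ℕ} (k : Lat d) (z : ℂ) (hz : ‖z‖ = 1) (s : ℝ) :
    sobNorm s (tst k z) ≤ 3 * jap k ^ s := by
  unfold sobNorm
  have hp := Real.rpow_nonneg (jap_pos k).le s
  apply Real.sqrt_le_iff.mpr
  refine ⟨by positivity, ?_⟩
  rw [tsum_eq_sum (s := ({k, -k} : Finset (Lat d)))
    (fun m hm => by rw [tst_zero k z m hm]; simp)]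
  have hsq : jap k ^ (2 * s) = (jap k ^ s) ^ 2 := by
    rw [mul_comm, Real.rpow_mul (jap_pos k).le]; norm_cast
  have hb : ∀ m ∈ ({k, -k} : Finset (Lat d)),
      jap m ^ (2 * s) * ‖tst k z m‖ ^ 2 ≤ 4 * (jap k ^ s) ^ 2 := by
    intro m hm
    have : jap m = jap k := by
      simp only [Finset.mem_insert, Finset.mem_singleton] at hm
      rcases hm with h | h <;> simp [h, jap_neg]
    rw [this, hsq]
    have h2 : ‖tst k z m‖ ^ 2 ≤ 2 ^ 2 := pow_le_pow_left₀ (norm_nonneg _) (tst_norm k z hz m) 2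
    nlinarith [sq_nonneg (jap k ^ s)]
  have := Finset.sum_le_card_nsmul _ _ _ hb
  refine this.trans ?_
  have hc : ((({k, -k} : Finset (Lat d)).card : ℕ) : ℝ) ≤ 2 := by
    exact_mod_cast Finset.card_le_two
  rw [nsmul_eq_mul]
  nlinarith [sq_nonneg (jap k ^ s)]

lemma hasSum_delta {d : ℕ} (F : Coef2 d) (a b : Lat d) :
    HasSum (fun p : Lat d × Lat d => (if -p.1 = a then (1 : ℂ) else 0) *
      (if -p.2 = b then 1 else 0) * F p) (F (-a, -b)) := by
  have := hasSum_single (f := fun p : Lat d × Lat d => (if -p.1 = a then (1 : ℂ) else 0) *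
      (if -p.2 = b then 1 else 0) * F p) (-a, -b) (by
    rintro ⟨p, q⟩ hpq
    by_cases h1 : -p = a
    · by_cases h2 : -q = b
      · exact absurd (by simp [← h1, ← h2]) hpq
      · simp [h2]
    · simp [h1])
  simpa using this

lemma pair_tst {d : ℕ} (F : Coef2 d) (a b : Lat d) (z w : ℂ) :
    pairTensor F (tst a z) (tst b w) =
      z * w * F (-a, -b) + z * (starRingEnd ℂ) w * F (-a, b)
      + (starRingEnd ℂ) z * w * F (a, -b)
      + (starRingEnd ℂ) z * (starRingEnd ℂ) w * F (a, b) := by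
  unfold pairTensor
  apply HasSum.tsum_eq
  have h1 := (hasSum_delta F a b).mul_left (z * w)
  have h2 := (hasSum_delta F a (-b)).mul_left (z * (starRingEnd ℂ) w)
  have h3 := (hasSum_delta F (-a) b).mul_left ((starRingEnd ℂ) z * w)
  have h4 := (hasSum_delta F (-a) (-b)).mul_left ((starRingEnd ℂ) z * (starRingEnd ℂ) w)
  rw [neg_neg] at h2 h3
  rw [neg_neg, neg_neg] at h4
  refine (((h1.add h2).add h3).add h4).congr_fun ?_
  intro p
  simp only [tst]
  ring

lemma coef_bound {d : ℕ} (s : ℝ) (F : Coef2 d) (M : ℝ) (hM : 0 ≤ M)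
    (H : ∀ h h' : Coef d, RapidDecay h → RapidDecay h' →
          IsRealDist h → IsRealDist h' →
          ‖pairTensor F h h'‖ ≤ M * sobNorm s h * sobNorm s h') (k : Lat d × Lat d) :
    ‖F k‖ ≤ 9 * M * (jap k.1 ^ s * jap k.2 ^ s) := by
  obtain ⟨a, b⟩ := k
  simp only
  have hB : ∀ z w : ℂ, ‖z‖ = 1 → ‖w‖ = 1 →
      ‖pairTensor F (tst (-a) z) (tst (-b) w)‖ ≤ 9 * M * (jap a ^ s * jap b ^ s) := by
    intro z w hz hw
    refine (H _ _ (tst_rapid _ z hz) (tst_rapid _ w hw) (tst_real _ z) (tst_real _ w)).trans ?_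
    have h1 := tst_sob (-a) z hz s
    have h2 := tst_sob (-b) w hw s
    rw [jap_neg] at h1 h2
    have n2 : 0 ≤ sobNorm s (tst (-b) w) := Real.sqrt_nonneg _
    have p1 := Real.rpow_nonneg (jap_pos a).le s
    calc _ ≤ M * (3 * jap a ^ s) * (3 * jap b ^ s) := by gcongr
      _ = _ := by ring
  have key : (4 : ℂ) * F (a, b) = pairTensor F (tst (-a) 1) (tst (-b) 1)
      - I * pairTensor F (tst (-a) I) (tst (-b) 1)
      - I * pairTensor F (tst (-a) 1) (tst (-b) I)
      - pairTensor F (tst (-a) I) (tst (-b) I) := by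
    simp only [pair_tst, neg_neg, map_one, Complex.conj_I]
    ring_nf
    simp only [Complex.I_sq]
    ring
  have hn : ‖(4 : ℂ) * F (a, b)‖ = 4 * ‖F (a, b)‖ := by simp
  have b1 := hB 1 1 (by simp) (by simp)
  have b2 := hB I 1 (by simp) (by simp)
  have b3 := hB 1 I (by simp) (by simp)
  have b4 := hB I I (by simp) (by simp)
  have t := norm_sub_le (pairTensor F (tst (-a) 1) (tst (-b) 1)
      - I * pairTensor F (tst (-a) I) (tst (-b) 1)
      - I * pairTensor F (tst (-a) 1) (tst (-b) I)) (pairTensor F (tst (-a) I) (tst (-b) I))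
  have t2 := norm_sub_le (pairTensor F (tst (-a) 1) (tst (-b) 1)
      - I * pairTensor F (tst (-a) I) (tst (-b) 1))
      (I * pairTensor F (tst (-a) 1) (tst (-b) I))
  have t3 := norm_sub_le (pairTensor F (tst (-a) 1) (tst (-b) 1))
      (I * pairTensor F (tst (-a) I) (tst (-b) 1))
  rw [← key, hn] at t
  rw [norm_mul, Complex.norm_I, one_mul] at t2 t3
  linarith

/-- let `d ≥ 1`, `λ > 3d/2`, and let `F` be a distribution on
`𝕋^d × 𝕋^d` with `|⟨F, h ⊗ h̃⟩| ≤ M ‖h‖_{H^{-λ-2}} ‖h̃‖_{H^{-λ-2}}` for all smooth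
(real-valued) `h, h̃` on `𝕋^d`.  Then for every `λ̃ ∈ (3d/2, λ)` one has
`F ∈ H^{λ̃+2-d/2}(𝕋^d × 𝕋^d)` with `‖F‖_{H^{λ̃+2-d/2}} ≤ C M`, where
`C = C(d, λ, λ̃)`. -/
theorem statement6
    (d : ℕ) (hd : 1 ≤ d) (lam : ℝ) (hlam : 3 * (d : ℝ) / 2 < lam)
    (tlam : ℝ) (htlam1 : 3 * (d : ℝ) / 2 < tlam) (htlam2 : tlam < lam) :
    ∃ C : ℝ, 0 < C ∧
      ∀ (F : Coef2 d) (M : ℝ), 0 ≤ M →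
        (∀ h h' : Coef d, RapidDecay h → RapidDecay h' →
          IsRealDist h → IsRealDist h' →
          ‖pairTensor F h h'‖ ≤ M * sobNorm (-(lam + 2)) h * sobNorm (-(lam + 2)) h') →
        MemSob2 (tlam + 2 - (d : ℝ) / 2) F ∧
        sobNorm2 (tlam + 2 - (d : ℝ) / 2) F ≤ C * M := by
  set r : ℝ := 2 * (tlam - lam) - d with hr
  have hdpos : (0 : ℝ) ≤ d := Nat.cast_nonneg d
  have hg : Summable fun k : Lat d => jap k ^ r := summable_jap r (by rw [hr]; linarith)
  have hg2 : Summable fun k : Lat d × Lat d => jap k.1 ^ r * jap k.2 ^ r :=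
    hg.mul_of_nonneg hg (fun k => Real.rpow_nonneg (jap_pos k).le _)
      (fun k => Real.rpow_nonneg (jap_pos k).le _)
  set S : ℝ := ∑' k : Lat d × Lat d, jap k.1 ^ r * jap k.2 ^ r with hS
  have hS0 : 0 ≤ S := tsum_nonneg fun k =>
    mul_nonneg (Real.rpow_nonneg (jap_pos k.1).le _) (Real.rpow_nonneg (jap_pos k.2).le _)
  refine ⟨9 * Real.sqrt S + 1, by positivity, ?_⟩
  intro F M hM H
  have hb := coef_bound (-(lam + 2)) F M hM H
  have hterm : ∀ k : Lat d × Lat d,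
      jap2 k ^ (2 * (tlam + 2 - (d : ℝ) / 2)) * ‖F k‖ ^ 2
        ≤ (9 * M) ^ 2 * (jap k.1 ^ r * jap k.2 ^ r) := by
    intro k
    have p1 := jap_pos k.1
    have p2 := jap_pos k.2
    have h1 : jap2 k ^ (2 * (tlam + 2 - (d : ℝ) / 2))
        ≤ (jap k.1 * jap k.2) ^ (2 * (tlam + 2 - (d : ℝ) / 2)) :=
      Real.rpow_le_rpow (jap2_pos k).le (jap2_le k) (by linarith)
    have h2 : ‖F k‖ ^ 2 ≤ (9 * M * (jap k.1 ^ (-(lam + 2)) * jap k.2 ^ (-(lam + 2)))) ^ 2 :=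
      pow_le_pow_left₀ (norm_nonneg _) (hb k) 2
    have e : ∀ x : ℝ, 0 < x →
        x ^ r = x ^ (2 * (tlam + 2 - (d : ℝ) / 2)) * (x ^ (-(lam + 2))) ^ 2 := by
      intro x hx
      rw [← Real.rpow_natCast (x ^ (-(lam + 2))) 2, ← Real.rpow_mul hx.le, ← Real.rpow_add hx]
      congr 1
      rw [hr]
      push_cast
      ring
    calc _ ≤ (jap k.1 * jap k.2) ^ (2 * (tlam + 2 - (d : ℝ) / 2)) *
          (9 * M * (jap k.1 ^ (-(lam + 2)) * jap k.2 ^ (-(lam + 2)))) ^ 2 := by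
          gcongr
      _ = _ := by
          rw [Real.mul_rpow p1.le p2.le, e _ p1, e _ p2]
          ring
  have hmem : MemSob2 (tlam + 2 - (d : ℝ) / 2) F := by
    refine Summable.of_nonneg_of_le (fun k => ?_) hterm (hg2.mul_left _)
    exact mul_nonneg (Real.rpow_nonneg (jap2_pos k).le _) (sq_nonneg _)
  refine ⟨hmem, ?_⟩
  have hle : ∑' k : Lat d × Lat d, jap2 k ^ (2 * (tlam + 2 - (d : ℝ) / 2)) * ‖F k‖ ^ 2
      ≤ (9 * M) ^ 2 * S := by
    rw [hS, ← tsum_mul_left]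
    exact Summable.tsum_le_tsum hterm hmem (hg2.mul_left _)
  unfold sobNorm2
  refine (Real.sqrt_le_sqrt hle).trans ?_
  rw [Real.sqrt_mul (sq_nonneg _), Real.sqrt_sq (by positivity)]
  nlinarith [Real.sqrt_nonneg S]

end PaperTorus
end
end

section
/- Let d ≥ 1, s > d and F ∈ H^{s+2}(𝕋^d × 𝕋^d). Then for every j ∈ {1,…,d}, the function of one variable x ↦ (∂_{x_j}∂_{y_j} F)(x, x), obtained by restricting the mixed second partial derivative ∂_{x_j}∂_{y_j} F (which is a continuous function on 𝕋^d × 𝕋^d) to the diagonal, belongs to H^{s'}(𝕋^d) for every s' ≤ s − d/2, and its norm satisfies ‖(∂_{x_j}∂_{y_j} F)(·, ·)|_{x=y}‖_{H^{s'}(𝕋^d)} ≤ C ‖F‖_{H^{s+2}(𝕋^d × 𝕋^d)} for a constant C depending only on d, s, s'. -/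
open MeasureTheory Complex Filter
open scoped BigOperators

noncomputable section
namespace PaperTorus

/-- Pairings of the restriction to the diagonal `g(x) = G(x,x)` of a continuous
function `G` on `𝕋^d × 𝕋^d`: `⟨g, e_n⟩ = Σ_{l₁+l₂=n} ⟨G, e_{(l₁,l₂)}⟩`. -/
def diagCoef {d : ℕ} (G : Coef2 d) : Coef d :=
  fun n => ∑' l : Lat d, G (l, n - l)

/-- Pairings of the mixed second partial derivative `∂_{x_j} ∂_{y_j} F` of a
distribution `F` on `𝕋^d × 𝕋^d`:
`⟨∂_{x_j}∂_{y_j} F, e_{(m₁,m₂)}⟩ = (-2πi (m₁)_j)(-2πi (m₂)_j) ⟨F, e_{(m₁,m₂)}⟩`. -/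
def mixedDeriv {d : ℕ} (j : Fin d) (F : Coef2 d) : Coef2 d := fun m =>
  (-(2 * (Real.pi : ℂ) * Complex.I * (m.1 j : ℂ))) *
    (-(2 * (Real.pi : ℂ) * Complex.I * (m.2 j : ℂ))) * F m

lemma oneD_nat (R : ℝ) (hR : 1 ≤ R) (N : ℕ) :
    ∑ m ∈ Finset.range N, 1 / (R ^ 2 + (m : ℝ) ^ 2) ≤ 4 / R - 4 / (R + N) := by
  induction N with
  | zero => simp
  | succ N ih =>
    rw [Finset.sum_range_succ]
    have hN : (0 : ℝ) ≤ N := Nat.cast_nonneg N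
    have h : 1 / (R ^ 2 + (N : ℝ) ^ 2) ≤ 4 / (R + N) - 4 / (R + N + 1) := by
      have e : 4 / (R + N) - 4 / (R + N + 1) = 4 / ((R + N) * (R + N + 1)) := by
        field_simp
        ring
      rw [e, div_le_div_iff₀ (by positivity) (by positivity)]
      nlinarith [sq_nonneg (R - N), mul_nonneg hN (by linarith : (0:ℝ) ≤ R)]
    push_cast
    rw [← add_assoc]
    linarith

lemma oneD_int (R : ℝ) (hR : 1 ≤ R) (N : ℕ) :
    ∑ m ∈ Finset.Ioo (-(N : ℤ)) N, 1 / (R ^ 2 + (m : ℝ) ^ 2) ≤ 8 / R := by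
  have hR0 : 0 < R := by linarith
  have hsub : Finset.Ioo (-(N : ℤ)) N ⊆
      (Finset.range N).image (fun n : ℕ => (n : ℤ)) ∪
        (Finset.range N).image (fun n : ℕ => -(n : ℤ)) := by
    intro m hm
    simp only [Finset.mem_Ioo] at hm
    simp only [Finset.mem_union, Finset.mem_image, Finset.mem_range]
    rcases le_total 0 m with h | h
    · left; exact ⟨m.toNat, by omega, by omega⟩
    · right; exact ⟨(-m).toNat, by omega, by omega⟩
  have hb : ∑ m ∈ Finset.range N, 1 / (R ^ 2 + (m : ℝ) ^ 2) ≤ 4 / R :=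
    (oneD_nat R hR N).trans (by
      have : 0 ≤ 4 / (R + N) := by positivity
      linarith)
  have e1 : ∑ m ∈ (Finset.range N).image (fun n : ℕ => (n : ℤ)),
      1 / (R ^ 2 + (m : ℝ) ^ 2) ≤ 4 / R := by
    rw [Finset.sum_image (by intro a _ b _ h; simpa using h)]
    simpa using hb
  have e2 : ∑ m ∈ (Finset.range N).image (fun n : ℕ => -(n : ℤ)),
      1 / (R ^ 2 + (m : ℝ) ^ 2) ≤ 4 / R := by
    rw [Finset.sum_image (by intro a _ b _ h; simpa using h)]
    simpa using hb
  have h1 := Finset.sum_le_sum_of_subset_of_nonneg (f := fun m : ℤ => 1 / (R ^ 2 + (m : ℝ) ^ 2))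
    hsub (fun _ _ _ => by positivity)
  have h2 := Finset.sum_union_inter
    (s₁ := (Finset.range N).image (fun n : ℕ => (n : ℤ)))
    (s₂ := (Finset.range N).image (fun n : ℕ => -(n : ℤ)))
    (f := fun m : ℤ => 1 / (R ^ 2 + (m : ℝ) ^ 2))
  have h3 : 0 ≤ ∑ m ∈ (Finset.range N).image (fun n : ℕ => (n : ℤ)) ∩
      (Finset.range N).image (fun n : ℕ => -(n : ℤ)), 1 / (R ^ 2 + (m : ℝ) ^ 2) :=
    Finset.sum_nonneg (fun _ _ => by positivity)
  have h4 : 8 / R = 4 / R + 4 / R := by ring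
  linarith

/-- every finite set of modes lies in a box -/
lemma exists_box {d : ℕ} (S : Finset (Lat d)) :
    ∃ N : ℕ, S ⊆ Fintype.piFinset (fun _ : Fin d => Finset.Ioo (-(N : ℤ)) N) := by
  refine ⟨(∑ l ∈ S, ∑ i, (l i).natAbs) + 1, ?_⟩
  intro l hl
  rw [Fintype.mem_piFinset]
  intro i
  have h1 : (l i).natAbs ≤ ∑ i, (l i).natAbs :=
    Finset.single_le_sum (f := fun i => (l i).natAbs) (fun _ _ => Nat.zero_le _)
      (Finset.mem_univ i)
  have h2 : ∑ i, (l i).natAbs ≤ ∑ l ∈ S, ∑ i, (l i).natAbs :=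
    Finset.single_le_sum (f := fun l : Lat d => ∑ i, (l i).natAbs) (fun _ _ => Nat.zero_le _) hl
  rw [Finset.mem_Ioo]
  omega

def Qf {d : ℕ} (k : Lat d × Lat d) : ℝ :=
  1 + ∑ i, ((k.1 i : ℝ)) ^ 2 + ∑ i, ((k.2 i : ℝ)) ^ 2

lemma Qf_one_le {d : ℕ} (k : Lat d × Lat d) : 1 ≤ Qf k := by
  have h1 : 0 ≤ ∑ i, ((k.1 i : ℝ)) ^ 2 := Finset.sum_nonneg (fun _ _ => sq_nonneg _)
  have h2 : 0 ≤ ∑ i, ((k.2 i : ℝ)) ^ 2 := Finset.sum_nonneg (fun _ _ => sq_nonneg _)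
  unfold Qf; linarith

lemma jap2_rpow {d : ℕ} (k : Lat d × Lat d) (t : ℝ) : jap2 k ^ (2 * t) = Qf k ^ t := by
  have h := Qf_one_le k
  unfold jap2
  change Real.sqrt (Qf k) ^ (2 * t) = _
  rw [Real.rpow_mul (Real.sqrt_nonneg _)]
  congr 1
  rw [Real.rpow_two, Real.sq_sqrt (by linarith)]

lemma jap_sq {d : ℕ} (n : Lat d) : jap n ^ 2 = 1 + ∑ i, ((n i : ℝ)) ^ 2 :=
  Real.sq_sqrt (add_nonneg zero_le_one (Finset.sum_nonneg (fun _ _ => sq_nonneg _)))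

lemma jap_one_le {d : ℕ} (n : Lat d) : 1 ≤ jap n := by
  unfold jap
  rw [Real.one_le_sqrt]
  have h1 : 0 ≤ ∑ i, ((n i : ℝ)) ^ 2 := Finset.sum_nonneg (fun _ _ => sq_nonneg _)
  linarith

lemma Qf_lower {d : ℕ} (n l : Lat d) (i : Fin d) :
    jap n ^ 2 + (l i : ℝ) ^ 2 ≤ 3 * Qf (l, n - l) := by
  rw [jap_sq]
  have h1 : (l i : ℝ) ^ 2 ≤ ∑ i, ((l i : ℝ)) ^ 2 :=
    Finset.single_le_sum (f := fun i => ((l i : ℝ)) ^ 2) (fun _ _ => sq_nonneg _)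
      (Finset.mem_univ i)
  have h2 : ∑ i, ((n i : ℝ)) ^ 2 ≤
      2 * ∑ i, ((l i : ℝ)) ^ 2 + 2 * ∑ i, (((n - l) i : ℤ) : ℝ) ^ 2 := by
    rw [Finset.mul_sum, Finset.mul_sum, ← Finset.sum_add_distrib]
    refine Finset.sum_le_sum (fun i _ => ?_)
    simp only [Pi.sub_apply, Int.cast_sub]
    nlinarith [sq_nonneg ((n i : ℝ) - 2 * l i)]
  have h3 : 0 ≤ ∑ i, (((n - l) i : ℤ) : ℝ) ^ 2 := Finset.sum_nonneg (fun _ _ => sq_nonneg _)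
  unfold Qf
  dsimp only
  linarith

lemma Qf_pow_le {d : ℕ} (hd : 1 ≤ d) (s : ℝ) (hs : (d : ℝ) < s) (n l : Lat d) :
    Qf (l, n - l) ^ (-s) ≤
      ∏ i, ((3 : ℝ) ^ (s / d) * jap n ^ (2 - 2 * (s / d)) * (1 / (jap n ^ 2 + (l i : ℝ) ^ 2))) := by
  have hd0 : (0 : ℝ) < d := by exact_mod_cast hd
  have ha : 1 < s / d := by rw [lt_div_iff₀ hd0]; linarith
  set a := s / d with ha'
  have hQ := Qf_one_le (l, n - l)
  have hR := jap_one_le n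
  have e : Qf (l, n - l) ^ (-s) = ∏ _i : Fin d, Qf (l, n - l) ^ (-a) := by
    rw [Finset.prod_const, Finset.card_univ, Fintype.card_fin, ← Real.rpow_natCast,
      ← Real.rpow_mul (by linarith)]
    congr 1
    rw [ha']; field_simp
  rw [e]
  refine Finset.prod_le_prod (fun i _ => Real.rpow_nonneg (by linarith) _) (fun i _ => ?_)
  set T := jap n ^ 2 + (l i : ℝ) ^ 2 with hT
  have hT0 : 0 < T := by positivity
  have hTR : jap n ^ 2 ≤ T := by rw [hT]; nlinarith [sq_nonneg (l i : ℝ)]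
  have hTQ : T / 3 ≤ Qf (l, n - l) := by
    have := Qf_lower n l i
    linarith
  calc Qf (l, n - l) ^ (-a) ≤ (T / 3) ^ (-a) :=
        Real.rpow_le_rpow_of_nonpos (by positivity) hTQ (by linarith)
    _ = 3 ^ a * T ^ (1 - a) * (1 / T) := by
        rw [Real.div_rpow hT0.le (by norm_num), Real.rpow_neg (by norm_num : (0:ℝ) ≤ 3),
          show -a = (1 - a) - 1 by ring, Real.rpow_sub_one hT0.ne']
        field_simp
    _ ≤ 3 ^ a * jap n ^ (2 - 2 * a) * (1 / T) := by
        gcongr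
        calc T ^ (1 - a) ≤ (jap n ^ 2) ^ (1 - a) :=
              Real.rpow_le_rpow_of_nonpos (by positivity) hTR (by linarith)
          _ = jap n ^ (2 - 2 * a) := by
              rw [← Real.rpow_natCast, ← Real.rpow_mul (by linarith)]
              congr 1; push_cast; ring

lemma sum_Qf {d : ℕ} (hd : 1 ≤ d) (s : ℝ) (hs : (d : ℝ) < s) (n : Lat d) (S : Finset (Lat d)) :
    ∑ l ∈ S, Qf (l, n - l) ^ (-s) ≤ (8 * (3 : ℝ) ^ (s / d)) ^ d * jap n ^ (d - 2 * s) := by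
  have hd0 : (0 : ℝ) < d := by exact_mod_cast hd
  have hR := jap_one_le n
  have hR0 : 0 < jap n := by linarith
  obtain ⟨N, hN⟩ := exists_box S
  set c := (3 : ℝ) ^ (s / d) * jap n ^ (2 - 2 * (s / d)) with hc
  have hc0 : 0 ≤ c := by positivity
  have hB : ∑ m ∈ Finset.Ioo (-(N : ℤ)) N, c * (1 / (jap n ^ 2 + (m : ℝ) ^ 2)) ≤ c * (8 / jap n) := by
    rw [← Finset.mul_sum]
    exact mul_le_mul_of_nonneg_left (oneD_int _ hR N) hc0
  calc ∑ l ∈ S, Qf (l, n - l) ^ (-s)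
      ≤ ∑ l ∈ S, ∏ i, (c * (1 / (jap n ^ 2 + (l i : ℝ) ^ 2))) :=
        Finset.sum_le_sum (fun l _ => Qf_pow_le hd s hs n l)
    _ ≤ ∑ l ∈ Fintype.piFinset (fun _ : Fin d => Finset.Ioo (-(N : ℤ)) N),
          ∏ i, (c * (1 / (jap n ^ 2 + (l i : ℝ) ^ 2))) :=
        Finset.sum_le_sum_of_subset_of_nonneg hN
          (fun _ _ _ => Finset.prod_nonneg (fun _ _ => by positivity))
    _ = ∏ _i : Fin d, ∑ m ∈ Finset.Ioo (-(N : ℤ)) N, c * (1 / (jap n ^ 2 + (m : ℝ) ^ 2)) :=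
        (Finset.prod_univ_sum (fun _ : Fin d => Finset.Ioo (-(N : ℤ)) N)
          (fun _ m => c * (1 / (jap n ^ 2 + (m : ℝ) ^ 2)))).symm
    _ ≤ ∏ _i : Fin d, (c * (8 / jap n)) :=
        Finset.prod_le_prod (fun _ _ => Finset.sum_nonneg (fun _ _ => by positivity))
          (fun _ _ => hB)
    _ = (8 * (3 : ℝ) ^ (s / d)) ^ d * jap n ^ (d - 2 * s) := by
        rw [Finset.prod_const, Finset.card_univ, Fintype.card_fin]
        have : c * (8 / jap n) = (8 * (3 : ℝ) ^ (s / d)) * jap n ^ (1 - 2 * (s / d)) := by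
          rw [hc, show (1 - 2 * (s / d) : ℝ) = (2 - 2 * (s / d)) - 1 by ring,
            Real.rpow_sub_one hR0.ne']
          ring
        rw [this, mul_pow]
        congr 1
        rw [← Real.rpow_natCast, ← Real.rpow_mul hR0.le]
        congr 1
        field_simp

/-- Cauchy-Schwarz for series. -/
lemma cs_series {ι : Type*} {E : Type*} [NormedAddCommGroup E] [CompleteSpace E]
    (g : ι → E) (u w : ι → ℝ) (A : ℝ) (hu : ∀ i, 0 ≤ u i)
    (hw : ∀ i, 0 ≤ w i) (hA : ∀ S : Finset ι, ∑ i ∈ S, u i ≤ A) (hws : Summable w)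
    (hg : ∀ i, ‖g i‖ ^ 2 ≤ u i * w i) :
    Summable g ∧ ‖∑' i, g i‖ ^ 2 ≤ A * ∑' i, w i := by
  have hA0 : 0 ≤ A := by simpa using hA ∅
  have hW0 : 0 ≤ ∑' i, w i := tsum_nonneg hw
  have hfin : ∀ S : Finset ι, ∑ i ∈ S, ‖g i‖ ≤ Real.sqrt (A * ∑' i, w i) := by
    intro S
    apply Real.le_sqrt_of_sq_le
    calc (∑ i ∈ S, ‖g i‖) ^ 2 ≤ (∑ i ∈ S, u i) * ∑ i ∈ S, w i :=
          Finset.sum_sq_le_sum_mul_sum_of_sq_le_mul S (fun i _ => hu i)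
            (fun i _ => hw i) (fun i _ => hg i)
      _ ≤ A * ∑' i, w i :=
          mul_le_mul (hA S) (hws.sum_le_tsum S (fun i _ => hw i))
            (Finset.sum_nonneg (fun i _ => hw i)) hA0
  have hsn : Summable (fun i => ‖g i‖) := summable_of_sum_le (fun _ => norm_nonneg _) hfin
  refine ⟨hsn.of_norm, ?_⟩
  have h1 : ‖∑' i, g i‖ ≤ Real.sqrt (A * ∑' i, w i) :=
    (norm_tsum_le_tsum_norm hsn).trans (hsn.tsum_le_of_sum_le hfin)
  calc ‖∑' i, g i‖ ^ 2 ≤ (Real.sqrt (A * ∑' i, w i)) ^ 2 :=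
        pow_le_pow_left₀ (norm_nonneg _) h1 2
    _ = _ := Real.sq_sqrt (mul_nonneg hA0 hW0)

lemma mixed_bound {d : ℕ} (j : Fin d) (F : Coef2 d) (s : ℝ) (k : Lat d × Lat d) :
    ‖mixedDeriv j F k‖ ^ 2 ≤
      Qf k ^ (-s) * ((4 * Real.pi ^ 2) ^ 2 * (Qf k ^ (s + 2) * ‖F k‖ ^ 2)) := by
  have hQ := Qf_one_le k
  have hQ0 : 0 < Qf k := by linarith
  have e1 : Qf k ^ (-s) * Qf k ^ (s + 2) = Qf k ^ 2 := by
    rw [← Real.rpow_add hQ0, ← Real.rpow_two]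
    congr 1; ring
  have e2 : Qf k ^ (-s) * ((4 * Real.pi ^ 2) ^ 2 * (Qf k ^ (s + 2) * ‖F k‖ ^ 2)) =
      (4 * Real.pi ^ 2 * Qf k * ‖F k‖) ^ 2 := by
    linear_combination (4 * Real.pi ^ 2) ^ 2 * ‖F k‖ ^ 2 * e1
  rw [e2]
  refine pow_le_pow_left₀ (norm_nonneg _) ?_ 2
  have h1 : (k.1 j : ℝ) ^ 2 ≤ ∑ i, ((k.1 i : ℝ)) ^ 2 :=
    Finset.single_le_sum (f := fun i => ((k.1 i : ℝ)) ^ 2) (fun _ _ => sq_nonneg _)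
      (Finset.mem_univ j)
  have h2 : (k.2 j : ℝ) ^ 2 ≤ ∑ i, ((k.2 i : ℝ)) ^ 2 :=
    Finset.single_le_sum (f := fun i => ((k.2 i : ℝ)) ^ 2) (fun _ _ => sq_nonneg _)
      (Finset.mem_univ j)
  have h3 : |(k.1 j : ℝ)| * |(k.2 j : ℝ)| ≤ Qf k := by
    unfold Qf
    nlinarith [sq_nonneg (|(k.1 j : ℝ)| - |(k.2 j : ℝ)|), sq_abs (k.1 j : ℝ), sq_abs (k.2 j : ℝ),
      sq_nonneg (k.1 j : ℝ), sq_nonneg (k.2 j : ℝ)]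
  unfold mixedDeriv
  simp only [norm_mul, norm_neg, Complex.norm_I, Complex.norm_real, Complex.norm_intCast,
    Real.norm_eq_abs, abs_of_pos Real.pi_pos, Complex.norm_ofNat]
  calc _ = 4 * Real.pi ^ 2 * (|(k.1 j : ℝ)| * |(k.2 j : ℝ)|) * ‖F k‖ := by ring
    _ ≤ _ := by gcongr

def shear (d : ℕ) : Lat d × Lat d ≃ Lat d × Lat d where
  toFun p := (p.2, p.1 - p.2)
  invFun q := (q.1 + q.2, q.1)
  left_inv p := by simp
  right_inv q := by simp

/-- let `d ≥ 1`, `s > d` and `F ∈ H^{s+2}(𝕋^d × 𝕋^d)`.  Then for every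
`j`, the restriction of the continuous function `∂_{x_j}∂_{y_j} F` to the diagonal
belongs to `H^{s'}(𝕋^d)` for every `s' ≤ s − d/2`, with norm bounded by
`C ‖F‖_{H^{s+2}(𝕋^d × 𝕋^d)}`, `C = C(d, s, s')`. -/
theorem statement7
    (d : ℕ) (hd : 1 ≤ d) (s s' : ℝ) (hs : (d : ℝ) < s) (hs' : s' ≤ s - (d : ℝ) / 2) :
    ∃ C : ℝ, 0 < C ∧
      ∀ F : Coef2 d, MemSob2 (s + 2) F → ∀ j : Fin d,
        (∀ n : Lat d, Summable fun l : Lat d => mixedDeriv j F (l, n - l)) ∧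
        MemSob s' (diagCoef (mixedDeriv j F)) ∧
        sobNorm s' (diagCoef (mixedDeriv j F)) ≤ C * sobNorm2 (s + 2) F := by
  have hd0 : (0 : ℝ) < d := by exact_mod_cast hd
  set K : ℝ := (8 * (3 : ℝ) ^ (s / d)) ^ d with hK
  have hK0 : 0 < K := by positivity
  set P : ℝ := (4 * Real.pi ^ 2) ^ 2 with hP
  have hP0 : 0 < P := by have := Real.pi_pos; positivity
  refine ⟨Real.sqrt (K * P), Real.sqrt_pos.2 (by positivity), ?_⟩
  intro F hF j
  have hF' : Summable fun k : Lat d × Lat d => Qf k ^ (s + 2) * ‖F k‖ ^ 2 := by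
    have := hF
    unfold MemSob2 at this
    simpa only [jap2_rpow] using this
  have hnn : ∀ k : Lat d × Lat d, 0 ≤ Qf k ^ (s + 2) * ‖F k‖ ^ 2 := fun k =>
    mul_nonneg (Real.rpow_nonneg (by linarith [Qf_one_le k]) _) (sq_nonneg _)
  have hsh : Summable fun p : Lat d × Lat d =>
      Qf (p.2, p.1 - p.2) ^ (s + 2) * ‖F (p.2, p.1 - p.2)‖ ^ 2 :=
    (shear d).summable_iff.2 hF'
  have htot : ∑' p : Lat d × Lat d,
      Qf (p.2, p.1 - p.2) ^ (s + 2) * ‖F (p.2, p.1 - p.2)‖ ^ 2 =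
      ∑' k : Lat d × Lat d, Qf k ^ (s + 2) * ‖F k‖ ^ 2 :=
    (shear d).tsum_eq (fun k => Qf k ^ (s + 2) * ‖F k‖ ^ 2)
  have hfib : ∀ n : Lat d, Summable fun l : Lat d =>
      Qf (l, n - l) ^ (s + 2) * ‖F (l, n - l)‖ ^ 2 := fun n => hsh.prod_factor n
  set W : Lat d → ℝ := fun n => ∑' l : Lat d, Qf (l, n - l) ^ (s + 2) * ‖F (l, n - l)‖ ^ 2 with hW
  have hWs : Summable W := hsh.prod
  have hWt : ∑' n, W n = ∑' k : Lat d × Lat d, Qf k ^ (s + 2) * ‖F k‖ ^ 2 := by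
    rw [← htot]; exact hsh.tsum_prod.symm
  have hW0 : ∀ n, 0 ≤ W n := fun n => tsum_nonneg (fun l => hnn _)
  have key : ∀ n : Lat d, (Summable fun l : Lat d => mixedDeriv j F (l, n - l)) ∧
      ‖∑' l : Lat d, mixedDeriv j F (l, n - l)‖ ^ 2 ≤
        (K * jap n ^ ((d : ℝ) - 2 * s)) *
          ∑' l : Lat d, P * (Qf (l, n - l) ^ (s + 2) * ‖F (l, n - l)‖ ^ 2) := fun n =>
    cs_series (fun l : Lat d => mixedDeriv j F (l, n - l)) (fun l => Qf (l, n - l) ^ (-s))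
      (fun l => P * (Qf (l, n - l) ^ (s + 2) * ‖F (l, n - l)‖ ^ 2)) _
      (fun l => Real.rpow_nonneg (by linarith [Qf_one_le (l, n - l)]) _)
      (fun l => mul_nonneg hP0.le (hnn _))
      (sum_Qf hd s hs n) ((hfib n).mul_left P) (fun l => mixed_bound j F s _)
  have hbd : ∀ n : Lat d, jap n ^ (2 * s') * ‖diagCoef (mixedDeriv j F) n‖ ^ 2 ≤
      K * P * W n := by
    intro n
    have hR := jap_one_le n
    have hR0 : 0 < jap n := by linarith
    have h1 := (key n).2
    rw [tsum_mul_left] at h1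
    have h2 : jap n ^ (2 * s') * jap n ^ ((d : ℝ) - 2 * s) ≤ 1 := by
      rw [← Real.rpow_add hR0]
      exact Real.rpow_le_one_of_one_le_of_nonpos hR (by linarith)
    calc jap n ^ (2 * s') * ‖diagCoef (mixedDeriv j F) n‖ ^ 2
        ≤ jap n ^ (2 * s') * ((K * jap n ^ ((d : ℝ) - 2 * s)) * (P * W n)) :=
          mul_le_mul_of_nonneg_left h1 (by positivity)
      _ = (jap n ^ (2 * s') * jap n ^ ((d : ℝ) - 2 * s)) * (K * P * W n) := by ring
      _ ≤ 1 * (K * P * W n) :=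
          mul_le_mul_of_nonneg_right h2 (mul_nonneg (by positivity) (hW0 n))
      _ = K * P * W n := one_mul _
  have hmem : MemSob s' (diagCoef (mixedDeriv j F)) :=
    Summable.of_nonneg_of_le
      (fun n => mul_nonneg (Real.rpow_nonneg (by linarith [jap_one_le n]) _) (sq_nonneg _))
      hbd (hWs.mul_left _)
  refine ⟨fun n => (key n).1, hmem, ?_⟩
  unfold sobNorm sobNorm2
  rw [← Real.sqrt_mul (by positivity)]
  apply Real.sqrt_le_sqrt
  simp only [jap2_rpow]
  rw [← hWt, ← tsum_mul_left]
  exact Summable.tsum_le_tsum hbd hmem (hWs.mul_left _)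

end PaperTorus
end
end
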